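/- arXiv:math/0606759 — 6 statements merged into one kernel-verified Lean document; each statement's English description precedes it below -/
import Mathlib

section
/- Let V be a finite-dimensional real vector space, ω an alternating bilinear form on V, and J : V → V a linear map with J ∘ J = -id, ω(Jv, Jw) = ω(v, w) for all v, w, and ω(v, Jv) > 0 for all v ≠ 0. Let g(v, w) := ω(v, Jw) be the associated inner product. Suppose L : V → V is a linear map that is g-symmetric (g(Lv, w) = g(v, Lw) for all v, w), anticommutes with J (L ∘ J = -J ∘ L), and satisfies g(Lv, Lv) < g(v, v) for all v ≠ 0. Then R := id + L is invertible, and the linear map J̃ := R ∘ J ∘ R⁻¹ satisfies: J̃ ∘ J̃ = -id, ω(J̃v, J̃w) = ω(v, w) for all v, w, and ω(v, J̃v) > 0 for all v ≠ 0. -/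
/-- Let `J` be an `ω`-calibrated almost complex structure on a
finite-dimensional real vector space `V`, with associated inner product
`g(v,w) := ω(v,Jw)`. If `L` is a `g`-symmetric endomorphism anticommuting with `J`
with `g(Lv,Lv) < g(v,v)` for all `v ≠ 0`, then `R := id + L` is invertible and
`J̃ := R ∘ J ∘ R⁻¹` is again an `ω`-calibrated almost complex structure. -/
theorem stmt_1 (V : Type*) [AddCommGroup V] [Module ℝ V] [FiniteDimensional ℝ V]
    (ω : V →ₗ[ℝ] V →ₗ[ℝ] ℝ) (halt : ∀ v : V, ω v v = 0)
    (J : V →ₗ[ℝ] V) (hJ : J ∘ₗ J = -LinearMap.id)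
    (hcal : ∀ v w : V, ω (J v) (J w) = ω v w)
    (hpos : ∀ v : V, v ≠ 0 → 0 < ω v (J v))
    (L : V →ₗ[ℝ] V)
    (hsym : ∀ v w : V, ω (L v) (J w) = ω v (J (L w)))
    (hanti : L ∘ₗ J = -(J ∘ₗ L))
    (hnorm : ∀ v : V, v ≠ 0 → ω (L v) (J (L v)) < ω v (J v)) :
    Function.Bijective (LinearMap.id + L : V →ₗ[ℝ] V) ∧
    ∀ S : V →ₗ[ℝ] V,
      (LinearMap.id + L) ∘ₗ S = LinearMap.id →
      S ∘ₗ (LinearMap.id + L) = LinearMap.id →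
      (((LinearMap.id + L) ∘ₗ J ∘ₗ S) ∘ₗ ((LinearMap.id + L) ∘ₗ J ∘ₗ S)
          = -LinearMap.id ∧
       (∀ v w : V, ω (((LinearMap.id + L) ∘ₗ J ∘ₗ S) v)
          (((LinearMap.id + L) ∘ₗ J ∘ₗ S) w) = ω v w) ∧
       (∀ v : V, v ≠ 0 → 0 < ω v (((LinearMap.id + L) ∘ₗ J ∘ₗ S) v))) := by
  have hJJ : ∀ v, J (J v) = -v := fun v => by simpa using LinearMap.congr_fun hJ v
  have hLJ : ∀ v, L (J v) = -J (L v) := fun v => by simpa using LinearMap.congr_fun hanti v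
  have hskew : ∀ v w, ω (L v) w = -ω v (L w) := fun v w => by
    rw [eq_comm, neg_eq_iff_eq_neg, eq_comm]
    simpa [hJJ, hLJ] using hsym v (J w)
  have hR : ∀ x y, ω (x + L x) (y + L y) = ω x y + ω (L x) (L y) := fun x y => by
    simp only [map_add, LinearMap.add_apply, hskew x y]
    ring
  have hinj : Function.Injective (LinearMap.id + L : V →ₗ[ℝ] V) := by
    rw [← LinearMap.ker_eq_bot, LinearMap.ker_eq_bot']
    intro v hv
    by_contra hne
    have hLv : L v = -v := eq_neg_of_add_eq_zero_right (by simpa using hv)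
    have h := hnorm v hne
    simp [hLv] at h
  refine ⟨⟨hinj, LinearMap.injective_iff_surjective.mp hinj⟩, fun S hRS hSR => ?_⟩
  have hRS' : ∀ v, S v + L (S v) = v := fun v => by simpa using LinearMap.congr_fun hRS v
  have hSR' : ∀ v, S (v + L v) = v := fun v => LinearMap.congr_fun hSR v
  have happ : ∀ v, ((LinearMap.id + L) ∘ₗ J ∘ₗ S) v = J (S v) + L (J (S v)) := fun _ => rfl
  refine ⟨?_, fun v w => ?_, fun v hv => ?_⟩
  · ext v
    rw [LinearMap.comp_apply, happ, happ, hSR', hJJ, map_neg, ← neg_add, hRS']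
    rfl
  · rw [happ, happ, hR, hLJ, hLJ, hcal, map_neg, map_neg, LinearMap.neg_apply, neg_neg, hcal,
      ← hR, hRS', hRS']
  · have hSv : S v ≠ 0 := fun h => hv (by simpa [h] using (hRS' v).symm)
    have h : ω v (J (S v) + L (J (S v))) = ω (S v) (J (S v)) - ω (L (S v)) (J (L (S v))) := by
      calc ω v (J (S v) + L (J (S v)))
          = ω (S v + L (S v)) (J (S v) + L (J (S v))) := by rw [hRS']
        _ = _ := by rw [hR, hLJ, map_neg, sub_eq_add_neg]
    rw [happ, h]
    exact sub_pos.mpr (hnorm _ hSv)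
end

section
/- Let V be a real vector space and J, L : V → V linear maps with J ∘ J = -id and L ∘ J = -J ∘ L. Suppose R := id + L is bijective, and set J̃ := R ∘ J ∘ R⁻¹. Then for every ℝ-linear map D : V → ℂ and every X ∈ V: D(R X) + i · D(J̃(R X)) = (D(X) + i · D(J X)) + (D(L X) - i · D(J (L X))), where i denotes the imaginary unit of ℂ. -/
/-- For an almost complex structure `J` on a real vector space `V`, an
endomorphism `L` anticommuting with `J` such that `R := id + L` is bijective with
two-sided inverse `S`, and `J̃ := R ∘ J ∘ S`, every `ℝ`-linear map `D : V → ℂ`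
satisfies `D(RX) + i·D(J̃(RX)) = (D(X) + i·D(JX)) + (D(LX) - i·D(J(LX)))`. -/
theorem stmt_3 (V : Type*) [AddCommGroup V] [Module ℝ V]
    (J L : V →ₗ[ℝ] V) (hJ : J ∘ₗ J = -LinearMap.id)
    (hanti : L ∘ₗ J = -(J ∘ₗ L))
    (S : V →ₗ[ℝ] V)
    (hRS : (LinearMap.id + L) ∘ₗ S = LinearMap.id)
    (hSR : S ∘ₗ (LinearMap.id + L) = LinearMap.id)
    (D : V →ₗ[ℝ] ℂ) (X : V) :
    D ((LinearMap.id + L : V →ₗ[ℝ] V) X)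
      + Complex.I * D (((LinearMap.id + L) ∘ₗ J ∘ₗ S) ((LinearMap.id + L : V →ₗ[ℝ] V) X))
    = (D X + Complex.I * D (J X)) + (D (L X) - Complex.I * D (J (L X))) := by
  have hS : S ((LinearMap.id + L : V →ₗ[ℝ] V) X) = X := LinearMap.congr_fun hSR X
  have hL : L (J X) = -J (L X) := LinearMap.congr_fun hanti X
  rw [LinearMap.comp_apply, LinearMap.comp_apply, hS]
  simp only [LinearMap.add_apply, LinearMap.id_apply, hL, map_add, map_neg]
  ring
end

section
/- Let n ≥ 1 and let a, b : ℝ^{2n} → ℝ be smooth functions that are ℤ^{2n}-periodic, i.e. a(x + m) = a(x) and b(x + m) = b(x) for every x ∈ ℝ^{2n} and every m ∈ ℤ^{2n}. Suppose there exist constants c_1, …, c_n and d_1, …, d_n in ℝ such that for every s ∈ {1, …, n} and every x ∈ ℝ^{2n}: ∂a/∂x_s(x) - ∂b/∂x_{n+s}(x) = c_s and ∂b/∂x_s(x) + ∂a/∂x_{n+s}(x) = d_s. Then a and b are constant functions, and consequently c_s = d_s = 0 for all s. -/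
/-- A continuous `ℤ^ι`-periodic function has bounded range. -/
lemma exists_abs_le_of_periodic {ι : Type*} {f : (ι → ℝ) → ℝ} (hf : Continuous f)
    (hp : ∀ (x : ι → ℝ) (m : ι → ℤ), f (x + fun i => (m i : ℝ)) = f x) :
    ∃ M, ∀ x, |f x| ≤ M := by
  obtain ⟨M, hM⟩ := (isCompact_Icc (a := (0 : ι → ℝ)) (b := 1)).exists_bound_of_continuousOn
    hf.continuousOn
  refine ⟨M, fun x => ?_⟩
  have h := hM (fun i => Int.fract (x i))
    ⟨fun i => Int.fract_nonneg _, fun i => (Int.fract_lt_one _).le⟩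
  have hx : ((fun i => Int.fract (x i)) + fun i => ((⌊x i⌋ : ℤ) : ℝ)) = x :=
    funext fun i => Int.fract_add_floor (x i)
  rwa [← hp _ fun i => ⌊x i⌋, hx] at h

/-- An entire function whose increments `z ↦ G (z + h) - G z` are all bounded is affine. -/
lemma Complex.eq_add_mul_of_bounded_increments {G : ℂ → ℂ} (hG : Differentiable ℂ G)
    (hb : ∀ h, ∃ M, ∀ z, ‖G (z + h) - G z‖ ≤ M) (z : ℂ) : G z = G 0 + deriv G 0 * z := by
  have hderiv : ∀ h, deriv G h = deriv G 0 := fun h => by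
    obtain ⟨M, hM⟩ := hb h
    have hd : Differentiable ℂ fun z => G (z + h) - G z := by fun_prop
    have hconst : (fun z => G (z + h) - G z) = fun _ => G (0 + h) - G 0 :=
      funext fun z => hd.apply_eq_apply_of_bounded
        (isBounded_iff_forall_norm_le.2 ⟨M, by rintro _ ⟨z, rfl⟩; exact hM z⟩) z 0
    have h0 := congrArg (fun f => deriv f 0) hconst
    have hs : DifferentiableAt ℂ (fun z => G (z + h)) 0 := by fun_prop
    simp only [deriv_const] at h0
    rw [deriv_fun_sub hs (hG 0), deriv_comp_add_const, zero_add] at h0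
    exact sub_eq_zero.1 h0
  have hd : Differentiable ℂ fun z => G z - deriv G 0 * z := by fun_prop
  have h := is_const_of_deriv_eq_zero hd (fun w => by
    rw [deriv_fun_sub (hG w) (by fun_prop), hderiv w]
    simp) z 0
  simp only [mul_zero, sub_zero] at h
  rw [← h]; ring

/-- A bounded solution of the inhomogeneous Cauchy-Riemann equation with constant right-hand side
which takes equal values at `0`, `1` and `I` is constant. -/
lemma Complex.apply_eq_apply_of_cauchyRiemann_const {F : ℂ → ℂ} (hF : Differentiable ℝ F)
    (hb : ∃ M, ∀ z, ‖F z‖ ≤ M) (h1 : F 1 = F 0) (hI : F I = F 0) {γ : ℂ}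
    (hCR : ∀ z, fderiv ℝ F z 1 + I * fderiv ℝ F z I = γ) (z w : ℂ) : F z = F w := by
  obtain ⟨M, hM⟩ := hb
  set G : ℂ → ℂ := fun z => F z - reCLM.smulRight γ z with hGdef
  have hG : Differentiable ℂ G := fun z => by
    have hfd : HasFDerivAt G (fderiv ℝ F z - reCLM.smulRight γ) z :=
      (hF z).hasFDerivAt.sub (reCLM.smulRight γ).hasFDerivAt
    refine differentiableAt_complex_iff_differentiableAt_real.2 ⟨hfd.differentiableAt, ?_⟩
    rw [hfd.fderiv, ← hCR z]
    simp
    linear_combination (fderiv ℝ F z I) * I_mul_I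
  have haff := Complex.eq_add_mul_of_bounded_increments hG fun h =>
    ⟨M + M + ‖h.re • γ‖, fun z => by
      have : G (z + h) - G z = F (z + h) - F z - h.re • γ := by
        simp [hGdef]; ring
      rw [this]
      exact (norm_sub_le _ _).trans
        (add_le_add_left ((norm_sub_le _ _).trans (add_le_add (hM _) (hM _))) _)⟩
  have hα : deriv G 0 = 0 := by
    have := haff I
    simpa [hGdef, hI] using this
  have hγ : γ = 0 := by
    have := haff 1
    rw [hα] at this
    simpa [hGdef, h1] using this
  have hFG : ∀ z, F z = F 0 := fun z => by
    have := haff z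
    rw [hα] at this
    simpa [hGdef, hγ] using this
  rw [hFG z, hFG w]

/-- A differentiable function on `ι → ℝ` with vanishing partial derivatives is constant. -/
lemma apply_eq_apply_of_fderiv_single_eq_zero {ι : Type*} [Fintype ι] [DecidableEq ι]
    {f : (ι → ℝ) → ℝ} (hf : Differentiable ℝ f)
    (h : ∀ x i, fderiv ℝ f x (Pi.single i 1) = 0) (x y : ι → ℝ) : f x = f y := by
  refine is_const_of_fderiv_eq_zero hf (fun x => ?_) x y
  refine ContinuousLinearMap.coe_injective ((Pi.basisFun ℝ ι).ext fun i => ?_)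
  simpa using h x i

/-- If `a` and `b` are bounded, periodic along `e` and `f`, and satisfy the Cauchy-Riemann
equations up to constants in the plane spanned by `e` and `f`, then their derivatives along
`e` and `f` vanish. -/
lemma fderiv_eq_zero_of_cauchyRiemann_const {E : Type*} [NormedAddCommGroup E] [NormedSpace ℝ E]
    {a b : E → ℝ} (ha : Differentiable ℝ a) (hb : Differentiable ℝ b)
    (hba : ∃ M, ∀ x, |a x| ≤ M) (hbb : ∃ M, ∀ x, |b x| ≤ M) {e f : E}
    (hae : ∀ x, a (x + e) = a x) (haf : ∀ x, a (x + f) = a x)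
    (hbe : ∀ x, b (x + e) = b x) (hbf : ∀ x, b (x + f) = b x) {c d : ℝ}
    (hc : ∀ x, fderiv ℝ a x e - fderiv ℝ b x f = c)
    (hd : ∀ x, fderiv ℝ b x e + fderiv ℝ a x f = d) (x : E) :
    (fderiv ℝ a x e = 0 ∧ fderiv ℝ a x f = 0) ∧ fderiv ℝ b x e = 0 ∧ fderiv ℝ b x f = 0 := by
  set L : ℂ →L[ℝ] E := Complex.reCLM.smulRight e + Complex.imCLM.smulRight f with hL
  have hL1 : L 1 = e := by simp [hL]
  have hLI : L Complex.I = f := by simp [hL]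
  set F : ℂ → ℂ := fun z => (a (x + L z) : ℂ) + b (x + L z) * Complex.I with hFdef
  have hder : ∀ z, HasFDerivAt F
      (Complex.ofRealCLM.comp ((fderiv ℝ a (x + L z)).comp L)
        + (Complex.ofRealCLM.comp ((fderiv ℝ b (x + L z)).comp L)).smulRight Complex.I) z := by
    intro z
    have hLz : HasFDerivAt (fun z => x + L z) L z := L.hasFDerivAt.const_add x
    have h1 := Complex.ofRealCLM.hasFDerivAt.comp z ((ha (x + L z)).hasFDerivAt.comp z hLz)
    have h2 := Complex.ofRealCLM.hasFDerivAt.comp z ((hb (x + L z)).hasFDerivAt.comp z hLz)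
    exact h1.add (h2.mul_const' Complex.I)
  have hval : ∀ z, fderiv ℝ F z 1 + Complex.I * fderiv ℝ F z Complex.I = c + d * Complex.I := by
    intro z
    rw [(hder z).fderiv, ← hc (x + L z), ← hd (x + L z)]
    simp [hL1, hLI]
    linear_combination (fderiv ℝ b (x + L z) f : ℂ) * Complex.I_mul_I
  obtain ⟨A, hA⟩ := hba
  obtain ⟨B, hB⟩ := hbb
  have hbound : ∀ z, ‖F z‖ ≤ A + B := fun z =>
    (norm_add_le _ _).trans (add_le_add (by simpa using hA _) (by simpa using hB _))
  have hconst := Complex.apply_eq_apply_of_cauchyRiemann_const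
    (fun z => (hder z).differentiableAt) ⟨_, hbound⟩ (by simp [hFdef, hL1, hae, hbe])
    (by simp [hFdef, hLI, haf, hbf]) hval
  have hzero : fderiv ℝ F 0 = 0 := by
    rw [show F = fun _ => F 0 from funext fun z => hconst z 0]
    simp
  rw [(hder 0).fderiv] at hzero
  have he := DFunLike.congr_fun hzero 1
  have hf := DFunLike.congr_fun hzero Complex.I
  simp [hL1, hLI, Complex.ext_iff] at he hf
  exact ⟨⟨he.1, hf.1⟩, he.2, hf.2⟩

/-- Smooth `ℤ^{2n}`-periodic functions `a, b : ℝ^{2n} → ℝ` (here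
`ℝ^{2n} = (Fin n ⊕ Fin n) → ℝ`, the first block of coordinates being
`x_1, …, x_n` and the second `x_{n+1}, …, x_{2n}`) satisfying
`∂a/∂x_s - ∂b/∂x_{n+s} = c_s` and `∂b/∂x_s + ∂a/∂x_{n+s} = d_s` for constants
`c_s, d_s` are constant, and all the `c_s, d_s` vanish. -/
theorem stmt_4 (n : ℕ) (hn : 1 ≤ n)
    (a b : ((Fin n ⊕ Fin n) → ℝ) → ℝ)
    (ha : ContDiff ℝ (⊤ : ℕ∞) a) (hb : ContDiff ℝ (⊤ : ℕ∞) b)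
    (hpa : ∀ (x : (Fin n ⊕ Fin n) → ℝ) (m : (Fin n ⊕ Fin n) → ℤ),
      a (x + fun i => (m i : ℝ)) = a x)
    (hpb : ∀ (x : (Fin n ⊕ Fin n) → ℝ) (m : (Fin n ⊕ Fin n) → ℤ),
      b (x + fun i => (m i : ℝ)) = b x)
    (c d : Fin n → ℝ)
    (hc : ∀ (s : Fin n) (x : (Fin n ⊕ Fin n) → ℝ),
      fderiv ℝ a x (Pi.single (Sum.inl s) 1)
        - fderiv ℝ b x (Pi.single (Sum.inr s) 1) = c s)
    (hd : ∀ (s : Fin n) (x : (Fin n ⊕ Fin n) → ℝ),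
      fderiv ℝ b x (Pi.single (Sum.inl s) 1)
        + fderiv ℝ a x (Pi.single (Sum.inr s) 1) = d s) :
    (∀ x y : (Fin n ⊕ Fin n) → ℝ, a x = a y) ∧
    (∀ x y : (Fin n ⊕ Fin n) → ℝ, b x = b y) ∧
    (∀ s : Fin n, c s = 0 ∧ d s = 0) := by
  have had : Differentiable ℝ a := ha.differentiable (by simp)
  have hbd : Differentiable ℝ b := hb.differentiable (by simp)
  have hsingle : ∀ i : Fin n ⊕ Fin n, (fun j => ((Pi.single i (1 : ℤ) : Fin n ⊕ Fin n → ℤ) j : ℝ))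
      = Pi.single i 1 := fun i => by
    ext j
    by_cases h : j = i <;> simp [h]
  have hae : ∀ i x, a (x + Pi.single i 1) = a x := fun i x => by
    rw [← hsingle i]; exact hpa x _
  have hbe : ∀ i x, b (x + Pi.single i 1) = b x := fun i x => by
    rw [← hsingle i]; exact hpb x _
  have key := fun s => fderiv_eq_zero_of_cauchyRiemann_const had hbd
    (exists_abs_le_of_periodic had.continuous hpa) (exists_abs_le_of_periodic hbd.continuous hpb)
    (hae (Sum.inl s)) (hae (Sum.inr s)) (hbe (Sum.inl s)) (hbe (Sum.inr s)) (hc s) (hd s)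
  refine ⟨apply_eq_apply_of_fderiv_single_eq_zero had ?_,
    apply_eq_apply_of_fderiv_single_eq_zero hbd ?_, fun s => ?_⟩
  · rintro x (s | s)
    exacts [(key s x).1.1, (key s x).1.2]
  · rintro x (s | s)
    exacts [(key s x).2.1, (key s x).2.2]
  · obtain ⟨⟨h1, h2⟩, h3, h4⟩ := key s 0
    rw [← hc s 0, ← hd s 0, h1, h2, h3, h4]
    simp
end

section
/- Let f : ℝ² → ℂ be a smooth function which is ℤ²-periodic, i.e. f(x + m, y + k) = f(x, y) for all (x, y) ∈ ℝ² and all integers m, k. Suppose f satisfies the equation ∂f/∂x(x, y) + i · ∂f/∂y(x, y) = f(x, y) for all (x, y) ∈ ℝ². Then f is identically zero. -/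
theorem exists_norm_le_of_int_periodic {E : Type*} [NormedAddCommGroup E] {f : ℝ × ℝ → E}
    (hf : Continuous f) (hper : ∀ (x y : ℝ) (m k : ℤ), f (x + m, y + k) = f (x, y)) :
    ∃ C, ∀ p, ‖f p‖ ≤ C := by
  obtain ⟨C, hC⟩ := (isCompact_Icc (a := (0 : ℝ)) (b := 1)).prod
    (isCompact_Icc (a := (0 : ℝ)) (b := 1)) |>.exists_bound_of_continuousOn hf.continuousOn
  refine ⟨C, fun ⟨x, y⟩ => ?_⟩
  have h := hper (Int.fract x) (Int.fract y) ⌊x⌋ ⌊y⌋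
  rw [Int.fract_add_floor, Int.fract_add_floor] at h
  rw [h]
  exact hC _ ⟨⟨Int.fract_nonneg x, (Int.fract_lt_one x).le⟩,
    ⟨Int.fract_nonneg y, (Int.fract_lt_one y).le⟩⟩

/-- Multiplying a solution of `∂f/∂x + i·∂f/∂y = f` by `exp (i y)` gives an entire function. -/
theorem differentiable_mul_exp_im {f : ℝ × ℝ → ℂ} (hf : Differentiable ℝ f)
    (heq : ∀ x y : ℝ,
      fderiv ℝ f (x, y) (1, 0) + Complex.I * fderiv ℝ f (x, y) (0, 1) = f (x, y)) :
    Differentiable ℂ fun z : ℂ => f (z.re, z.im) * Complex.exp (Complex.I * z.im) := by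
  intro z
  have hF : HasFDerivAt (fun z : ℂ => f (z.re, z.im))
      ((fderiv ℝ f (z.re, z.im)).comp (Complex.reCLM.prod Complex.imCLM)) z :=
    (hf (z.re, z.im)).hasFDerivAt.comp z (Complex.reCLM.prod Complex.imCLM).hasFDerivAt
  have hE : HasFDerivAt (fun z : ℂ => Complex.exp (Complex.I * z.im)) _ z :=
    ((Complex.ofRealCLM.comp Complex.imCLM).hasFDerivAt.const_mul Complex.I).cexp
  have hG := hF.mul hE
  rw [differentiableAt_complex_iff_differentiableAt_real]
  refine ⟨hG.differentiableAt, ?_⟩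
  have h := heq z.re z.im
  rw [HasFDerivAt.fderiv (f := fun z : ℂ => f (z.re, z.im) * Complex.exp (Complex.I * z.im)) hG]
  simp
  linear_combination (-(Complex.I * Complex.exp (Complex.I * z.im))) * h +
    Complex.exp (Complex.I * z.im) * fderiv ℝ f (z.re, z.im) (0, 1) * Complex.I_sq

/-- A smooth `ℤ²`-periodic function `f : ℝ² → ℂ` satisfying
`∂f/∂x + i·∂f/∂y = f` is identically zero. -/
theorem stmt_5 (f : ℝ × ℝ → ℂ) (hf : ContDiff ℝ (⊤ : ℕ∞) f)
    (hper : ∀ (x y : ℝ) (m k : ℤ), f (x + m, y + k) = f (x, y))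
    (heq : ∀ x y : ℝ,
      fderiv ℝ f (x, y) (1, 0) + Complex.I * fderiv ℝ f (x, y) (0, 1) = f (x, y)) :
    ∀ p : ℝ × ℝ, f p = 0 := by
  obtain ⟨C, hC⟩ := exists_norm_le_of_int_periodic hf.continuous hper
  have hd := differentiable_mul_exp_im (hf.differentiable (by simp)) heq
  have hb : Bornology.IsBounded
      (Set.range fun z : ℂ => f (z.re, z.im) * Complex.exp (Complex.I * z.im)) := by
    refine isBounded_iff_forall_norm_le.2 ⟨C, ?_⟩
    rintro _ ⟨z, rfl⟩
    simpa [mul_comm Complex.I, Complex.norm_exp_ofReal_mul_I] using hC (z.re, z.im)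
  rintro ⟨x, y⟩
  have h := hd.apply_eq_apply_of_bounded hb ⟨x, y + 1⟩ ⟨x, y⟩
  have hp : f (x, y + 1) = f (x, y) := by simpa using hper x y 0 1
  simp only [hp] at h
  by_contra hne
  have h1 := mul_left_cancel₀ hne h
  obtain ⟨n, hn⟩ := Complex.exp_eq_exp_iff_exists_int.1 h1
  have h2 : (1 : ℝ) = n * (2 * Real.pi) := by
    have := congrArg Complex.im hn
    simp at this
    linarith
  have hn0 : (0 : ℝ) < n := by
    by_contra! hle
    nlinarith [Real.pi_pos]
  have hn1 : (1 : ℝ) ≤ n := by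
    exact_mod_cast Int.add_one_le_iff.2 (by exact_mod_cast hn0 : (0 : ℤ) < n)
  nlinarith [Real.pi_gt_three]
end

section
/- Let f : ℝ³ → ℂ be a smooth function satisfying the invariance f(x + m, y + k, z + m·y + l) = f(x, y, z) for all (x, y, z) ∈ ℝ³ and all integers m, k, l. Suppose that for all (x, y, z) ∈ ℝ³: ∂f/∂z(x, y, z) = i · ( ∂f/∂y(x, y, z) + x · ∂f/∂z(x, y, z) ). Then ∂f/∂y and ∂f/∂z vanish identically; i.e. f depends only on the first variable x. -/
/-- The affine inclusion of the `(s, t)`-plane into the slice `{x} × ℝ²` adapted to the frame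
`∂/∂y + x ∂/∂z`, `∂/∂z`. -/
def sliceMap (x : ℝ) (w : ℂ) : ℝ × ℝ × ℝ := (x, w.re, x * w.re + w.im)

/-- The derivative of `sliceMap x`. -/
noncomputable def sliceMapDeriv (x : ℝ) : ℂ →L[ℝ] ℝ × ℝ × ℝ :=
  (0 : ℂ →L[ℝ] ℝ).prod (Complex.reCLM.prod (x • Complex.reCLM + Complex.imCLM))

theorem hasFDerivAt_sliceMap (x : ℝ) (w : ℂ) : HasFDerivAt (sliceMap x) (sliceMapDeriv x) w :=
  (hasFDerivAt_const x w).prodMk <| Complex.reCLM.hasFDerivAt.prodMk <|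
    (x • Complex.reCLM + Complex.imCLM).hasFDerivAt

theorem sliceMap_mk (x y z : ℝ) : sliceMap x ⟨y, z - x * y⟩ = (x, y, z) := by
  simp [sliceMap]

/-- A continuous function on the plane with period `1` in both variables is bounded. -/
theorem isBounded_range_of_periodic {E : Type*} [PseudoMetricSpace E] (g : ℝ × ℝ → E)
    (hg : Continuous g) (hper : ∀ (y z : ℝ) (k l : ℤ), g (y + k, z + l) = g (y, z)) :
    Bornology.IsBounded (Set.range g) := by
  refine (((isCompact_Icc (a := (0 : ℝ)) (b := 1)).prod
    (isCompact_Icc (a := (0 : ℝ)) (b := 1))).image hg).isBounded.subset ?_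
  rintro _ ⟨⟨y, z⟩, rfl⟩
  refine ⟨(Int.fract y, Int.fract z), ⟨⟨Int.fract_nonneg y, (Int.fract_lt_one y).le⟩,
    ⟨Int.fract_nonneg z, (Int.fract_lt_one z).le⟩⟩, ?_⟩
  rw [← hper _ _ ⌊y⌋ ⌊z⌋, Int.fract_add_floor, Int.fract_add_floor]

/-- A smooth function `f : ℝ³ → ℂ` invariant under
`(x,y,z) ↦ (x+m, y+k, z+m·y+l)` for all integers `m,k,l` and satisfying
`∂f/∂z = i·(∂f/∂y + x·∂f/∂z)` has `∂f/∂y ≡ 0` and `∂f/∂z ≡ 0`. -/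
theorem stmt_6 (f : ℝ × ℝ × ℝ → ℂ) (hf : ContDiff ℝ (⊤ : ℕ∞) f)
    (hinv : ∀ (x y z : ℝ) (m k l : ℤ),
      f (x + m, y + k, z + m * y + l) = f (x, y, z))
    (heq : ∀ x y z : ℝ,
      fderiv ℝ f (x, y, z) (0, 0, 1)
        = Complex.I * (fderiv ℝ f (x, y, z) (0, 1, 0)
            + (x : ℂ) * fderiv ℝ f (x, y, z) (0, 0, 1))) :
    ∀ p : ℝ × ℝ × ℝ,
      fderiv ℝ f p (0, 1, 0) = 0 ∧ fderiv ℝ f p (0, 0, 1) = 0 := by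
  rintro ⟨x, y, z⟩
  have hderiv (w : ℂ) : HasFDerivAt (f ∘ sliceMap x)
      ((fderiv ℝ f (sliceMap x w)).comp (sliceMapDeriv x)) w :=
    ((hf.differentiable (by simp)) _).hasFDerivAt.comp w (hasFDerivAt_sliceMap x w)
  have hone (w : ℂ) : fderiv ℝ f (sliceMap x w) (sliceMapDeriv x 1) =
      fderiv ℝ f (sliceMap x w) (0, 1, 0) + x * fderiv ℝ f (sliceMap x w) (0, 0, 1) := by
    have : sliceMapDeriv x 1 = (0, 1, 0) + x • ((0, 0, 1) : ℝ × ℝ × ℝ) := by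
      simp [sliceMapDeriv]
    rw [this, map_add, map_smul, Complex.real_smul]
  have hI : sliceMapDeriv x Complex.I = (0, 0, 1) := by simp [sliceMapDeriv]
  have hdiff : Differentiable ℂ (f ∘ sliceMap x) := fun w => by
    rw [differentiableAt_complex_iff_differentiableAt_real]
    refine ⟨(hderiv w).differentiableAt, ?_⟩
    rw [(hderiv w).fderiv, ContinuousLinearMap.comp_apply, ContinuousLinearMap.comp_apply, hone,
      hI, smul_eq_mul]
    exact heq _ _ _
  have hbdd : Bornology.IsBounded (Set.range (f ∘ sliceMap x)) := by
    refine (isBounded_range_of_periodic (fun q : ℝ × ℝ => f (x, q))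
      (hf.continuous.comp (by fun_prop)) fun y z k l => ?_).subset ?_
    · simpa using hinv x y z 0 k l
    · rintro _ ⟨w, rfl⟩
      exact ⟨(w.re, x * w.re + w.im), rfl⟩
  have hconst : f ∘ sliceMap x = fun _ => f (sliceMap x 0) :=
    funext fun w => hdiff.apply_eq_apply_of_bounded hbdd w 0
  have hzero (w v : ℂ) : fderiv ℝ f (sliceMap x w) (sliceMapDeriv x v) = 0 := by
    have h := hderiv w
    rw [hconst] at h
    exact DFunLike.congr_fun (h.unique (hasFDerivAt_const _ _)) v
  rw [← sliceMap_mk x y z]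
  have hz := hzero ⟨y, z - x * y⟩ Complex.I
  have hy := hzero ⟨y, z - x * y⟩ 1
  rw [hI] at hz
  rw [hone, hz, mul_zero, add_zero] at hy
  exact ⟨hy, hz⟩
end

section
/- Let f : ℝ⁶ → ℂ be a smooth function, and write f = u + iv with u, v : ℝ⁶ → ℝ. Suppose f satisfies the invariance f(x₁ + m₁, x₂ + m₂, x₃ + m₃, x₄ + m₄, x₅ + m₅, x₆ + m₄·x₅ + m₆) = f(x₁, x₂, x₃, x₄, x₅, x₆) for all points of ℝ⁶ and all integers m₁, …, m₆, and that the following equations hold identically on ℝ⁶: (a) ∂u/∂x₁ - ∂v/∂x₂ = 0 and ∂u/∂x₂ + ∂v/∂x₁ = 0; (b) ∂u/∂x₃ - ∂v/∂x₄ - u = 0 and ∂u/∂x₄ + ∂v/∂x₃ - v = 0; (c) ∂v/∂x₆ - ∂u/∂x₅ - x₄·∂u/∂x₆ = 0 and ∂u/∂x₆ + ∂v/∂x₅ + x₄·∂v/∂x₆ = 0. Then f is identically zero. -/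
open Complex in
/-- **Liouville's theorem along an affine plane**, for the equation `(∂_p + i ∂_q) f = r f` with
`r` real. -/
theorem exp_mul_apply_eq_of_bounded_of_fderiv {E : Type*} [NormedAddCommGroup E] [NormedSpace ℝ E]
    {f : E → ℂ} (hf : Differentiable ℝ f) (hb : Bornology.IsBounded (Set.range f)) (r : ℝ)
    (x p q : E)
    (h : ∀ s t : ℝ, fderiv ℝ f (x + s • p + t • q) p + I * fderiv ℝ f (x + s • p + t • q) q
      = r * f (x + s • p + t • q)) (s t : ℝ) :
    exp ((r * t : ℝ) * I) * f (x + s • p + t • q) = f x := by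
  set g : ℂ → E := fun z => x + z.re • p + z.im • q with hg
  set F : ℂ → ℂ := fun z => exp ((r * z.im : ℝ) * I) * f (g z) with hF
  have hg' (z : ℂ) : HasFDerivAt g (reCLM.smulRight p + imCLM.smulRight q) z :=
    ((reCLM.hasFDerivAt.smul_const p).const_add x).add (imCLM.hasFDerivAt.smul_const q)
  have he' (z : ℂ) : HasFDerivAt (fun z : ℂ => ((r * z.im : ℝ) : ℂ) * I)
      ((ofRealCLM.comp (r • imCLM)).smulRight I) z :=
    ((ofRealCLM.comp (r • imCLM)).smulRight I).hasFDerivAt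
  have hF' (z : ℂ) := (he' z).cexp.mul ((hf (g z)).hasFDerivAt.comp z (hg' z))
  have hdiff : Differentiable ℂ F := fun z => by
    refine differentiableAt_complex_iff_differentiableAt_real.2 ⟨(hF' z).differentiableAt, ?_⟩
    have hz : fderiv ℝ f (g z) p + I * fderiv ℝ f (g z) q = r * f (g z) := h z.re z.im
    rw [show fderiv ℝ F z = _ from (hF' z).fderiv]
    simp
    linear_combination (-I * exp (r * z.im * I)) * hz
      + (exp (r * z.im * I) * fderiv ℝ f (g z) q) * I_sq
  have hbdd : Bornology.IsBounded (Set.range F) := by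
    obtain ⟨C, hC⟩ := isBounded_iff_forall_norm_le.1 hb
    refine isBounded_iff_forall_norm_le.2 ⟨C, ?_⟩
    rintro _ ⟨z, rfl⟩
    simpa only [hF, norm_mul, norm_exp_ofReal_mul_I, one_mul] using hC _ ⟨g z, rfl⟩
  simpa [hF, hg] using hdiff.apply_eq_apply_of_bounded hbdd ⟨s, t⟩ 0

/-- A continuous function on `ℝ⁶` invariant under the lattice defining the product of a
two-torus and the Kodaira–Thurston manifold is bounded. -/
theorem isBounded_range_of_kodairaThurston_invariant {f : (Fin 6 → ℝ) → ℂ} (hf : Continuous f)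
    (hinv : ∀ (x : Fin 6 → ℝ) (m : Fin 6 → ℤ),
      f (x + (fun i => (m i : ℝ)) + Pi.single (5 : Fin 6) ((m 3 : ℝ) * x 4)) = f x) :
    Bornology.IsBounded (Set.range f) := by
  refine ((isCompact_Icc (a := (0 : Fin 6 → ℝ)) (b := 1)).image hf).isBounded.subset ?_
  rintro _ ⟨x, rfl⟩
  set m : Fin 6 → ℤ := Function.update (fun i => -⌊x i⌋) 5 (-⌊x 5 - ⌊x 3⌋ * x 4⌋) with hm
  refine ⟨_, ?_, hinv x m⟩
  have hfloor (y : ℝ) : 0 ≤ y + -⌊y⌋ ∧ y + -⌊y⌋ ≤ 1 :=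
    ⟨by linarith [Int.floor_le y], by linarith [Int.lt_floor_add_one y]⟩
  have key (i : Fin 6) :
      ∃ y : ℝ, (x + (fun i => (m i : ℝ)) + Pi.single (5 : Fin 6) ((m 3 : ℝ) * x 4) :
        Fin 6 → ℝ) i = y + -⌊y⌋ := by
    by_cases hi : i = 5
    · subst hi
      refine ⟨x 5 - ⌊x 3⌋ * x 4, ?_⟩
      simp [hm]
      ring
    · exact ⟨x i, by simp [hm, hi]⟩
  refine ⟨fun i => ?_, fun i => ?_⟩ <;> obtain ⟨y, hy⟩ := key i <;> rw [hy]
  exacts [(hfloor y).1, (hfloor y).2]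


/-- A smooth function `f = u + iv : ℝ⁶ → ℂ` invariant under the
identifications defining `T² × (Kodaira–Thurston manifold)`, i.e.
`f(x₁+m₁, …, x₅+m₅, x₆+m₄x₅+m₆) = f(x₁,…,x₆)`, and satisfying the systems
(a) `∂u/∂x₁ - ∂v/∂x₂ = 0`, `∂u/∂x₂ + ∂v/∂x₁ = 0`;
(b) `∂u/∂x₃ - ∂v/∂x₄ - u = 0`, `∂u/∂x₄ + ∂v/∂x₃ - v = 0`;
(c) `∂v/∂x₆ - ∂u/∂x₅ - x₄·∂u/∂x₆ = 0`, `∂u/∂x₆ + ∂v/∂x₅ + x₄·∂v/∂x₆ = 0`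
is identically zero. (Coordinates `x₁,…,x₆` are indexed by `0,…,5 : Fin 6`.) -/
theorem stmt_8 (f : (Fin 6 → ℝ) → ℂ) (u v : (Fin 6 → ℝ) → ℝ)
    (hf : ContDiff ℝ (⊤ : ℕ∞) f)
    (huv : ∀ x : Fin 6 → ℝ, f x = (u x : ℂ) + (v x : ℂ) * Complex.I)
    (hinv : ∀ (x : Fin 6 → ℝ) (m : Fin 6 → ℤ),
      f (x + (fun i => (m i : ℝ)) + Pi.single (5 : Fin 6) ((m 3 : ℝ) * x 4)) = f x)
    (ha : ∀ x : Fin 6 → ℝ,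
      fderiv ℝ u x (Pi.single (0 : Fin 6) 1) - fderiv ℝ v x (Pi.single (1 : Fin 6) 1) = 0 ∧
      fderiv ℝ u x (Pi.single (1 : Fin 6) 1) + fderiv ℝ v x (Pi.single (0 : Fin 6) 1) = 0)
    (hb : ∀ x : Fin 6 → ℝ,
      fderiv ℝ u x (Pi.single (2 : Fin 6) 1) - fderiv ℝ v x (Pi.single (3 : Fin 6) 1)
        - u x = 0 ∧
      fderiv ℝ u x (Pi.single (3 : Fin 6) 1) + fderiv ℝ v x (Pi.single (2 : Fin 6) 1)
        - v x = 0)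
    (hc : ∀ x : Fin 6 → ℝ,
      fderiv ℝ v x (Pi.single (5 : Fin 6) 1) - fderiv ℝ u x (Pi.single (4 : Fin 6) 1)
        - x 3 * fderiv ℝ u x (Pi.single (5 : Fin 6) 1) = 0 ∧
      fderiv ℝ u x (Pi.single (5 : Fin 6) 1) + fderiv ℝ v x (Pi.single (4 : Fin 6) 1)
        + x 3 * fderiv ℝ v x (Pi.single (5 : Fin 6) 1) = 0) :
    ∀ x : Fin 6 → ℝ, f x = 0 := by
  have hfd : Differentiable ℝ f := hf.differentiable (by simp)
  have hbdd := isBounded_range_of_kodairaThurston_invariant hf.continuous hinv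
  have hfderiv (x w : Fin 6 → ℝ) :
      fderiv ℝ f x w = fderiv ℝ u x w + fderiv ℝ v x w * Complex.I := by
    have hu : u = Complex.reCLM ∘ f := funext fun y => by simp [huv]
    have hv : v = Complex.imCLM ∘ f := funext fun y => by simp [huv]
    rw [hu, hv, (Complex.reCLM.hasFDerivAt.comp x (hfd x).hasFDerivAt).fderiv,
      (Complex.imCLM.hasFDerivAt.comp x (hfd x).hasFDerivAt).fderiv]
    simp
  intro x
  have hfiber (y : Fin 6 → ℝ) (t : ℝ) : f (y + t • Pi.single (5 : Fin 6) (1 : ℝ)) = f y := by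
    have key := exp_mul_apply_eq_of_bounded_of_fderiv hfd hbdd 0 y
      (Pi.single (4 : Fin 6) (1 : ℝ) + y 3 • Pi.single (5 : Fin 6) (1 : ℝ))
      (Pi.single (5 : Fin 6) (1 : ℝ)) ?_ 0 t
    · simpa using key
    · intro s t
      set z := y + s • (Pi.single (4 : Fin 6) (1 : ℝ) + y 3 • Pi.single (5 : Fin 6) (1 : ℝ))
        + t • Pi.single (5 : Fin 6) (1 : ℝ) with hz
      have hz3 : z 3 = y 3 := by simp [hz]
      obtain ⟨h₁, h₂⟩ := hc z
      rw [hz3] at h₁ h₂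
      simp only [map_add, map_smul, hfderiv]
      apply Complex.ext <;> simp <;> linarith
  have hshift : f (x + Pi.single (3 : Fin 6) (1 : ℝ)) = f x := by
    have h := hinv x (Pi.single 3 1)
    have hcast : (fun i => ((Pi.single (3 : Fin 6) (1 : ℤ) : Fin 6 → ℤ) i : ℝ))
        = Pi.single (3 : Fin 6) (1 : ℝ) := by
      ext i
      by_cases hi : i = 3
      · subst hi; simp
      · simp [hi]
    have hsingle : Pi.single (5 : Fin 6) (x 4) = x 4 • Pi.single (5 : Fin 6) (1 : ℝ) := by
      rw [← Pi.single_smul, smul_eq_mul, mul_one]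
    rwa [hcast, Pi.single_eq_same, Int.cast_one, one_mul, hsingle, hfiber] at h
  have hrot := exp_mul_apply_eq_of_bounded_of_fderiv hfd hbdd 1 x
    (Pi.single (2 : Fin 6) (1 : ℝ)) (Pi.single (3 : Fin 6) (1 : ℝ)) (fun s t => by
      obtain ⟨h₁, h₂⟩ := hb (x + s • Pi.single (2 : Fin 6) (1 : ℝ)
        + t • Pi.single (3 : Fin 6) (1 : ℝ))
      rw [hfderiv, hfderiv, huv]
      apply Complex.ext <;> simp <;> linarith) 0 1
  rw [zero_smul, add_zero, one_smul, hshift] at hrot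
  have hne : Complex.exp (((1 : ℝ) * (1 : ℝ) : ℝ) * Complex.I) ≠ 1 := by
    intro h
    have him := congrArg Complex.im h
    rw [Complex.exp_ofReal_mul_I_im] at him
    have hpos := Real.sin_pos_of_pos_of_le_one one_pos le_rfl
    norm_num at him
    linarith
  by_contra h
  exact hne (mul_right_cancel₀ h (hrot.trans (one_mul _).symm))
end
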